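/- arXiv:2206.09121 — 2 statements merged into one kernel-verified Lean document; each statement's English description precedes it below -/
import Mathlib

section
/- Let k be a field and f ∈ k[x_1,...,x_n] a homogeneous cubic of slice rank r. Then dim L_f ≤ r^2 + (r+1)^2/4 + r; equivalently, 4·dim L_f ≤ 4r^2 + (r+1)^2 + 4r. -/
open MvPolynomial

/-- The slice rank of a polynomial: minimal `r` such that `f` lies in an ideal
generated by `r` linear forms. -/
noncomputable def sliceRank {k : Type*} [Field k] {σ : Type*} (f : MvPolynomial σ k) : ℕ :=
  sInf {r : ℕ | ∃ ℓ : Fin r → MvPolynomial σ k,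
    (∀ i, (ℓ i).IsHomogeneous 1) ∧ f ∈ Ideal.span (Set.range ℓ)}

/-- `P_f`: the set of subspaces of linear forms of dimension `rk f` whose ideal contains `f`. -/
def slicePlanes {k : Type*} [Field k] {σ : Type*} (f : MvPolynomial σ k) :
    Set (Submodule k (MvPolynomial σ k)) :=
  {P | P ≤ homogeneousSubmodule σ k 1 ∧ Module.finrank k P = sliceRank f ∧
    f ∈ Ideal.span (P : Set (MvPolynomial σ k))}

/-- `L_f`: the sum of all subspaces in `P_f`. -/
noncomputable def Lspace {k : Type*} [Field k] {σ : Type*} (f : MvPolynomial σ k) :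
    Submodule k (MvPolynomial σ k) :=
  sSup (slicePlanes f)

section LinearForms

variable {k : Type*} [Field k]

/-- A subspace is the image of a projection which kills a given subspace disjoint from it. -/
lemma exists_projection_of_disjoint {V : Type*} [AddCommGroup V] [Module k V]
    {W Q : Submodule k V} (h : Disjoint W Q) :
    ∃ p : V →ₗ[k] V, (∀ x, p x ∈ W) ∧ (∀ x ∈ W, p x = x) ∧ ∀ x ∈ Q, p x = 0 := by
  obtain ⟨D, hQD, hD⟩ := h.symm.exists_isCompl
  refine ⟨W.subtype ∘ₗ Submodule.projectionOnto W D hD.symm, fun x => by simp,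
    fun x hx => ?_, fun x hx => ?_⟩
  · exact congrArg Subtype.val (Submodule.projectionOnto_apply_left hD.symm ⟨x, hx⟩)
  · have := (Submodule.projectionOnto_apply_eq_zero_iff hD.symm (x := x)).2 (hQD hx)
    simp [this]

lemma finiteDimensional_of_le_linearForms {σ : Type*} [Finite σ]
    {P : Submodule k (MvPolynomial σ k)} (hP : P ≤ homogeneousSubmodule σ k 1) :
    FiniteDimensional k P := by
  have : FiniteDimensional k (homogeneousSubmodule σ k 1) :=
    Module.Finite.iff_fg.2 (homogeneousSubmodule_fg σ k 1)
  exact Submodule.finiteDimensional_of_le hP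

lemma aeval_linear_of_mem_linearForms {σ : Type*}
    (p : MvPolynomial σ k →ₗ[k] MvPolynomial σ k) {x : MvPolynomial σ k}
    (hx : x ∈ homogeneousSubmodule σ k 1) : aeval (fun i => p (X i)) x = p x := by
  rw [homogeneousSubmodule_one_eq_span_X] at hx
  induction hx using Submodule.span_induction with
  | mem x h => obtain ⟨i, rfl⟩ := h; simp
  | zero => simp
  | add x y _ _ hx hy => rw [map_add, map_add, hx, hy]
  | smul a x _ hx => rw [map_smul, map_smul, hx]

lemma homogeneousComponent_mul_linear {σ : Type*} (d : ℕ) (a : MvPolynomial σ k)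
    {b : MvPolynomial σ k} (hb : b.IsHomogeneous 1) :
    homogeneousComponent (d + 1) (a * b) = homogeneousComponent d a * b := by
  let _ := MvPolynomial.gradedAlgebra (σ := σ) (R := k)
  have h := DirectSum.coe_decompose_mul_add_of_right_mem (homogeneousSubmodule σ k)
    (i := d) (a := a) ((mem_homogeneousSubmodule 1 b).2 hb)
  rwa [← decomposition.decompose'_apply, ← decomposition.decompose'_apply]

lemma ideal_span_eq_span_finBasis {A : Type*} [CommRing A] [Algebra k A] (P : Submodule k A)
    [FiniteDimensional k P] :
    Ideal.span (P : Set A) =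
      Ideal.span (Set.range fun i => (Module.finBasis k P i : A)) := by
  apply le_antisymm
  · rw [Ideal.span_le]
    intro x hx
    have h := congrArg Subtype.val ((Module.finBasis k P).sum_repr ⟨x, hx⟩)
    simp only [Submodule.coe_sum, Submodule.coe_smul] at h
    rw [SetLike.mem_coe, ← h]
    refine Ideal.sum_mem _ fun i _ => Submodule.smul_of_tower_mem _ _ ?_
    exact Ideal.subset_span ⟨i, rfl⟩
  · apply Ideal.span_mono
    rintro _ ⟨i, rfl⟩
    exact (Module.finBasis k P i).2

/-- The homogeneous components of an element of the ideal generated by a space of linear forms. -/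
lemma homogeneousComponent_eq_sum_of_mem_span {σ : Type*} [Finite σ]
    {P : Submodule k (MvPolynomial σ k)} [FiniteDimensional k P]
    (hP : P ≤ homogeneousSubmodule σ k 1) {x : MvPolynomial σ k}
    (hx : x ∈ Ideal.span (P : Set (MvPolynomial σ k))) (d : ℕ) :
    ∃ q : Fin (Module.finrank k P) → MvPolynomial σ k, (∀ i, (q i).IsHomogeneous d) ∧
      homogeneousComponent (d + 1) x = ∑ i, q i * (Module.finBasis k P i : MvPolynomial σ k) := by
  rw [ideal_span_eq_span_finBasis, Ideal.mem_span_range_iff_exists_fun] at hx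
  obtain ⟨c, rfl⟩ := hx
  refine ⟨fun i => homogeneousComponent d (c i),
    fun i => homogeneousComponent_isHomogeneous d _, ?_⟩
  rw [map_sum]
  exact Finset.sum_congr rfl fun i _ =>
    homogeneousComponent_mul_linear d _ (hP (Module.finBasis k P i).2)

lemma map_mem_ideal_span {A : Type*} [CommRing A] [Algebra k A]
    (φ : A →ₐ[k] A) {P : Set A} {I : Ideal A} (h : ∀ x ∈ P, φ x ∈ I) {f : A}
    (hf : f ∈ Ideal.span P) : φ f ∈ I :=
  (Ideal.span_le (I := I.comap φ)).2 h hf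

/-- If each variable changes by an element of an ideal, so does each polynomial. -/
lemma sub_aeval_mem {σ : Type*} (g : σ → MvPolynomial σ k) (I : Ideal (MvPolynomial σ k))
    (h : ∀ i, X i - g i ∈ I) (f : MvPolynomial σ k) : f - aeval g f ∈ I := by
  rw [← Ideal.Quotient.eq]
  have : Ideal.Quotient.mkₐ k I = (Ideal.Quotient.mkₐ k I).comp (aeval g) := by
    ext i
    simpa using Ideal.Quotient.eq.2 (h i)
  exact DFunLike.congr_fun this f

/-- A homogeneous cubic in `(B) ∩ (P)` is, modulo `(B ∩ P)`, a polynomial in `B`, `P` and few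
further linear forms. -/
lemma exists_linearForms_of_mem_inter {σ : Type*} [Finite σ]
    {B P : Submodule k (MvPolynomial σ k)} (hBL : B ≤ homogeneousSubmodule σ k 1)
    (hPL : P ≤ homogeneousSubmodule σ k 1) {h : MvPolynomial σ k} (hh : h.IsHomogeneous 3)
    (hB : h ∈ Ideal.span (B : Set (MvPolynomial σ k)))
    (hP : h ∈ Ideal.span (P : Set (MvPolynomial σ k))) :
    ∃ T ≤ homogeneousSubmodule σ k 1,
      Module.finrank k T + Module.finrank k (B ⊓ P : Submodule k (MvPolynomial σ k)) *
        Module.finrank k P ≤ Module.finrank k B * Module.finrank k P ∧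
      ∀ φ : MvPolynomial σ k →ₐ[k] MvPolynomial σ k,
        (∀ x ∈ B, φ x = x) → (∀ x ∈ P, φ x = x) → (∀ x ∈ T, φ x = x) →
        h - φ h ∈ Ideal.span ((B ⊓ P : Submodule k (MvPolynomial σ k)) :
          Set (MvPolynomial σ k)) := by
  have fB := finiteDimensional_of_le_linearForms hBL
  have fP := finiteDimensional_of_le_linearForms hPL
  obtain ⟨Q, hQ⟩ := (B ⊓ P).exists_isCompl
  obtain ⟨B', hB'⟩ : ∃ B', B' = Q ⊓ B := ⟨_, rfl⟩
  have hB'B : B' ≤ B := hB' ▸ inf_le_right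
  have fB' := finiteDimensional_of_le_linearForms (hB'B.trans hBL)
  have fC := finiteDimensional_of_le_linearForms
    ((inf_le_left : B ⊓ P ≤ B).trans hBL)
  have hsup : (B ⊓ P) ⊔ B' = B := by
    rw [hB', ← sup_inf_assoc_of_le _ inf_le_left, hQ.sup_eq_top, top_inf_eq]
  have hinf : (B ⊓ P) ⊓ B' = ⊥ := by
    rw [hB', ← inf_assoc, hQ.inf_eq_bot, bot_inf_eq]
  have hdim := Submodule.finrank_sup_add_finrank_inf_eq (B ⊓ P) B'
  rw [hsup, hinf, finrank_bot, add_zero] at hdim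
  have hdisj : Disjoint P B' := by
    rw [disjoint_iff, ← hinf, eq_comm, inf_assoc, inf_eq_right.2]
    exact inf_le_right.trans hB'B
  obtain ⟨p, hpP, hpid, hp0⟩ := exists_projection_of_disjoint hdisj
  -- `h` is a combination of a basis of `B'` modulo `(B ∩ P)`
  have hB2 : h ∈ Ideal.span (B' : Set (MvPolynomial σ k)) ⊔
      Ideal.span ((B ⊓ P : Submodule k (MvPolynomial σ k)) : Set (MvPolynomial σ k)) := by
    refine (Ideal.span_le.2 ?_) hB
    intro x hx
    rw [← hsup] at hx
    obtain ⟨y, hy, z, hz, rfl⟩ := Submodule.mem_sup.1 hx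
    exact Ideal.add_mem _ (Ideal.mem_sup_right (Ideal.subset_span hy))
      (Ideal.mem_sup_left (Ideal.subset_span hz))
  obtain ⟨u, hu, c, hc, huc⟩ := Submodule.mem_sup.1 hB2
  obtain ⟨q, hq, hqu⟩ := homogeneousComponent_eq_sum_of_mem_span (hB'B.trans hBL) hu 2
  obtain ⟨e, he, hec⟩ := homogeneousComponent_eq_sum_of_mem_span
    ((inf_le_left : B ⊓ P ≤ B).trans hBL) hc 2
  have hsum : h = homogeneousComponent 3 u + homogeneousComponent 3 c := by
    rw [← map_add, huc, homogeneousComponent_eq_self hh]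
  set c' := homogeneousComponent 3 c with hc'
  have hc'C : c' ∈ Ideal.span ((B ⊓ P : Submodule k (MvPolynomial σ k)) :
      Set (MvPolynomial σ k)) := by
    rw [hec]
    exact Ideal.sum_mem _ fun i _ => Ideal.mul_mem_left _ _
      (Ideal.subset_span (Module.finBasis k _ i).2)
  -- a substitution killing the plane `P` and fixing the complement
  let ρ : MvPolynomial σ k →ₐ[k] MvPolynomial σ k :=
    aeval (fun i => (LinearMap.id - p : MvPolynomial σ k →ₗ[k] MvPolynomial σ k) (X i))
  have hρ : ∀ x ∈ homogeneousSubmodule σ k 1, ρ x = x - p x := fun x hx =>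
    aeval_linear_of_mem_linearForms _ hx
  have hρP : ∀ x ∈ P, ρ x = 0 := fun x hx => by rw [hρ x (hPL hx), hpid x hx, sub_self]
  have hρkill : ∀ {x}, x ∈ Ideal.span (P : Set (MvPolynomial σ k)) → ρ x = 0 := fun hx => by
    simpa using map_mem_ideal_span (I := ⊥) ρ (by simpa using hρP) hx
  have hρB' : ∀ i, ρ (Module.finBasis k B' i : MvPolynomial σ k) = Module.finBasis k B' i := by
    intro i
    rw [hρ _ (hBL (hB'B (Module.finBasis k B' i).2)), hp0 _ (Module.finBasis k B' i).2, sub_zero]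
  have hρq : ∑ i, ρ (q i) * (Module.finBasis k B' i : MvPolynomial σ k) = 0 := by
    have h1 : ρ h = ρ (homogeneousComponent 3 u) + ρ c' := by rw [← map_add, ← hsum]
    rw [hρkill hP, hρkill (Ideal.span_mono (fun x hx => hx.2) hc'C), hqu, map_sum, add_zero] at h1
    rw [h1]
    exact Finset.sum_congr rfl fun i _ => by rw [map_mul, hρB']
  have hqP : ∀ i, q i - ρ (q i) ∈ Ideal.span (P : Set (MvPolynomial σ k)) := fun i =>
    sub_aeval_mem _ _ (fun j => by simpa using Ideal.subset_span (hpP (X j))) _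
  have hqhom : ∀ i, (q i - ρ (q i)).IsHomogeneous 2 := fun i =>
    (hq i).sub ((hq i).aeval (n := 1) _ fun j =>
      (isHomogeneous_X k j).sub (hPL (hpP (X j))))
  choose l hl hlq using fun i => homogeneousComponent_eq_sum_of_mem_span hPL (hqP i) 1
  refine ⟨Submodule.span k (Set.range fun ij : Fin (Module.finrank k B') ×
    Fin (Module.finrank k P) => l ij.1 ij.2), ?_, ?_, ?_⟩
  · rw [Submodule.span_le]
    rintro _ ⟨ij, rfl⟩
    exact hl _ _
  · have := finrank_range_le_card (R := k) (fun ij : Fin (Module.finrank k B') ×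
      Fin (Module.finrank k P) => l ij.1 ij.2)
    simp only [Set.finrank, Fintype.card_prod, Fintype.card_fin] at this
    rw [hdim, add_mul, add_comm]
    gcongr
  · intro φ hφB hφP hφT
    have key : h = ∑ i, (∑ j, l i j * (Module.finBasis k P j : MvPolynomial σ k)) *
        (Module.finBasis k B' i : MvPolynomial σ k) + c' := by
      rw [hsum, hqu]
      congr 1
      rw [← sub_zero (∑ i, q i * _), ← hρq, ← Finset.sum_sub_distrib]
      refine Finset.sum_congr rfl fun i _ => ?_
      rw [← sub_mul, ← hlq i, homogeneousComponent_eq_self (hqhom i)]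
    have hφh : h - φ h = c' - φ c' := by
      have hfix : φ (∑ i, (∑ j, l i j * (Module.finBasis k P j : MvPolynomial σ k)) *
          (Module.finBasis k B' i : MvPolynomial σ k)) =
          ∑ i, (∑ j, l i j * (Module.finBasis k P j : MvPolynomial σ k)) *
          (Module.finBasis k B' i : MvPolynomial σ k) := by
        rw [map_sum]
        refine Finset.sum_congr rfl fun i _ => ?_
        rw [map_mul, map_sum, hφB _ (hB'B (Module.finBasis k B' i).2)]
        congr 1
        refine Finset.sum_congr rfl fun j _ => ?_
        rw [map_mul, hφP _ (Module.finBasis k P j).2,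
          hφT _ (Submodule.subset_span ⟨(i, j), rfl⟩)]
      rw [key, map_add, hfix]
      ring
    rw [hφh]
    refine Ideal.sub_mem _ hc'C (map_mem_ideal_span φ (fun x hx => ?_) hc'C)
    rw [hφB x hx.1]
    exact Ideal.subset_span hx

/-- `f` is a polynomial in the elements of `W` modulo the ideal `(B)`: substitutions fixing `W`
do not change `f` modulo `(B)`. -/
def DependsOnMod {σ : Type*} (f : MvPolynomial σ k) (W B : Submodule k (MvPolynomial σ k)) :
    Prop :=
  ∀ φ : MvPolynomial σ k →ₐ[k] MvPolynomial σ k, (∀ x ∈ W, φ x = x) →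
    f - φ f ∈ Ideal.span (B : Set (MvPolynomial σ k))

lemma dependsOnMod_self {σ : Type*} {f : MvPolynomial σ k} {P : Submodule k (MvPolynomial σ k)}
    (hf : f ∈ Ideal.span (P : Set (MvPolynomial σ k))) : DependsOnMod f P P := fun φ hφ =>
  Ideal.sub_mem _ hf (map_mem_ideal_span φ
    (fun x hx => by rw [hφ x hx]; exact Ideal.subset_span hx) hf)

lemma DependsOnMod.exists_inf {σ : Type*} [Finite σ] {f : MvPolynomial σ k}
    (hf : f.IsHomogeneous 3) {W B P : Submodule k (MvPolynomial σ k)} (hdep : DependsOnMod f W B)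
    (hW : W ≤ homogeneousSubmodule σ k 1) (hB : B ≤ W)
    (hP : P ≤ homogeneousSubmodule σ k 1) (hfP : f ∈ Ideal.span (P : Set (MvPolynomial σ k))) :
    ∃ W' ≤ homogeneousSubmodule σ k 1, W ≤ W' ∧ DependsOnMod f W' (B ⊓ P) ∧
      Module.finrank k W' + Module.finrank k (B ⊓ P : Submodule k (MvPolynomial σ k)) *
        Module.finrank k P ≤ Module.finrank k (W ⊔ P : Submodule k (MvPolynomial σ k)) +
          Module.finrank k B * Module.finrank k P := by
  obtain ⟨p, hpW, hpid, -⟩ := exists_projection_of_disjoint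
    (disjoint_bot_right : Disjoint (W ⊔ P) ⊥)
  have hWP : W ⊔ P ≤ homogeneousSubmodule σ k 1 := sup_le hW hP
  let π : MvPolynomial σ k →ₐ[k] MvPolynomial σ k := aeval (fun i => p (X i))
  have hπ : ∀ x ∈ W ⊔ P, π x = x := fun x hx =>
    (aeval_linear_of_mem_linearForms p (hWP hx)).trans (hpid x hx)
  have hhom : (f - π f).IsHomogeneous 3 :=
    hf.sub (hf.aeval (n := 1) _ fun j => hWP (hpW (X j)))
  obtain ⟨T, hT, hTdim, hTφ⟩ := exists_linearForms_of_mem_inter (hB.trans hW) hP hhom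
    (hdep π fun x hx => hπ x (Submodule.mem_sup_left hx))
    (dependsOnMod_self hfP π fun x hx => hπ x (Submodule.mem_sup_right hx))
  have := finiteDimensional_of_le_linearForms hWP
  have := finiteDimensional_of_le_linearForms hT
  refine ⟨W ⊔ P ⊔ T, sup_le hWP hT, le_sup_left.trans le_sup_left, fun φ hφ => ?_, ?_⟩
  · have hφπ : φ (π f) = π f := by
      have : φ.comp π = π := by
        ext1 i
        simpa [π] using hφ _ (Submodule.mem_sup_left (hpW (X i)))
      exact DFunLike.congr_fun this f
    have := hTφ φ (fun x hx => hφ x (Submodule.mem_sup_left (Submodule.mem_sup_left (hB hx))))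
      (fun x hx => hφ x (Submodule.mem_sup_left (Submodule.mem_sup_right hx)))
      (fun x hx => hφ x (Submodule.mem_sup_right hx))
    rw [map_sub, hφπ] at this
    convert this using 1
    ring
  · have := Submodule.finrank_add_le_finrank_add_finrank (W ⊔ P) T
    omega

end LinearForms

section SliceRank

variable {k : Type*} [Field k] {σ : Type*} [Finite σ] {f : MvPolynomial σ k}

lemma sliceRank_le_finrank {P : Submodule k (MvPolynomial σ k)}
    (hP : P ≤ homogeneousSubmodule σ k 1) (hf : f ∈ Ideal.span (P : Set (MvPolynomial σ k))) :
    sliceRank f ≤ Module.finrank k P := by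
  have := finiteDimensional_of_le_linearForms hP
  rw [ideal_span_eq_span_finBasis] at hf
  exact Nat.sInf_le ⟨_, fun i => hP (Module.finBasis k P i).2, hf⟩

lemma le_of_dependsOnMod {W B P : Submodule k (MvPolynomial σ k)}
    (hW : W ≤ homogeneousSubmodule σ k 1) (hB : B ≤ W) (hdep : DependsOnMod f W B)
    (hP : P ∈ slicePlanes f) (hBP : B ≤ P) : P ≤ W := by
  obtain ⟨hPL, hPr, hfP⟩ := hP
  have := finiteDimensional_of_le_linearForms hPL
  intro x hx
  by_contra hxW
  obtain ⟨p, hpW, hpid, hp0⟩ := exists_projection_of_disjoint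
    (Submodule.disjoint_span_singleton_of_notMem hxW)
  let π : MvPolynomial σ k →ₐ[k] MvPolynomial σ k := aeval (fun i => p (X i))
  have hπ : ∀ y ∈ homogeneousSubmodule σ k 1, π y = p y := fun y hy =>
    aeval_linear_of_mem_linearForms p hy
  have hmap : f ∈ Ideal.span ((P.map p : Submodule k _) : Set (MvPolynomial σ k)) := by
    rw [← sub_add_cancel f (π f)]
    refine Ideal.add_mem _ (Ideal.span_mono ?_ (hdep π fun y hy => ?_))
      (map_mem_ideal_span π (fun y hy => ?_) hfP)
    · exact fun y hy => ⟨y, hBP hy, hpid y (hB hy)⟩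
    · rw [hπ y (hW hy), hpid y hy]
    · rw [hπ y (hPL hy)]
      exact Ideal.subset_span ⟨y, hy, rfl⟩
  have hle : P.map p ≤ homogeneousSubmodule σ k 1 := by
    rintro _ ⟨y, -, rfl⟩
    exact hW (hpW y)
  have h1 := sliceRank_le_finrank hle hmap
  have h2 := LinearMap.finrank_range_add_finrank_ker (p.domRestrict P)
  rw [LinearMap.range_domRestrict] at h2
  have h3 : 0 < Module.finrank k (LinearMap.ker (p.domRestrict P)) := by
    refine (Module.finrank_pos_iff_exists_ne_zero (R := k)
      (M := LinearMap.ker (p.domRestrict P))).2 ⟨⟨⟨x, hx⟩, ?_⟩, ?_⟩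
    · simpa using hp0 x (Submodule.mem_span_singleton_self x)
    · intro h0
      apply hxW
      have : x = 0 := by simpa using h0
      rw [this]
      exact W.zero_mem
  omega

/-- Intersecting `B` successively with the planes of `f` leads to a bound for all of them. -/
lemma exists_le_of_dependsOnMod (hf : f.IsHomogeneous 3) {P₀ : Submodule k (MvPolynomial σ k)}
    (hP₀ : P₀ ∈ slicePlanes f) {s : ℕ}
    (hs : ∀ P ∈ slicePlanes f, Module.finrank k (P₀ ⊔ P : Submodule k _) ≤ sliceRank f + s)
    (b : ℕ) (W B : Submodule k (MvPolynomial σ k)) (hb : Module.finrank k B = b)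
    (hW : W ≤ homogeneousSubmodule σ k 1) (hB : B ≤ W) (hPW : P₀ ≤ W)
    (hdep : DependsOnMod f W B) :
    ∃ W' : Submodule k (MvPolynomial σ k), FiniteDimensional k W' ∧
      (∀ P ∈ slicePlanes f, P ≤ W') ∧
      Module.finrank k W' ≤ Module.finrank k W + (s + sliceRank f) * b := by
  induction b using Nat.strong_induction_on generalizing W B with
  | _ b ih =>
    have fW := finiteDimensional_of_le_linearForms hW
    have fB := finiteDimensional_of_le_linearForms (hB.trans hW)
    by_cases hall : ∀ P ∈ slicePlanes f, B ≤ P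
    · exact ⟨W, fW, fun P hP => le_of_dependsOnMod hW hB hdep hP (hall P hP), by omega⟩
    push Not at hall
    obtain ⟨P, hP, hBP⟩ := hall
    have fP := finiteDimensional_of_le_linearForms hP.1
    have fP₀ := finiteDimensional_of_le_linearForms hP₀.1
    obtain ⟨W', hW', hWW', hdep', hdim⟩ := hdep.exists_inf hf hW hB hP.1 hP.2.2
    have hlt : Module.finrank k (B ⊓ P : Submodule k _) < b := by
      rw [← hb]
      exact Submodule.finrank_lt_finrank_of_lt (inf_lt_left.2 hBP)
    obtain ⟨W'', hfin, hall, hle⟩ := ih _ hlt W' (B ⊓ P) rfl hW'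
      (inf_le_left.trans (hB.trans hWW')) (hPW.trans hWW') hdep'
    refine ⟨W'', hfin, hall, hle.trans ?_⟩
    have h1 := Submodule.finrank_sup_add_finrank_inf_eq W P
    have h2 := Submodule.finrank_sup_add_finrank_inf_eq P₀ P
    have h3 : Module.finrank k (P₀ ⊓ P : Submodule k _) ≤
        Module.finrank k (W ⊓ P : Submodule k _) :=
      Submodule.finrank_mono (inf_le_inf_right P hPW)
    have h4 := hs P hP
    have h5 := hP.2.1
    have h6 := hP₀.2.1
    rw [hb, h5] at hdim
    have h7 : Module.finrank k (W ⊔ P : Submodule k _) ≤ Module.finrank k W + s := by omega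
    nlinarith [Nat.mul_le_mul_left s (Nat.succ_le_of_lt hlt)]

end SliceRank

/-- **Theorem A.** For a homogeneous cubic `f` of slice rank `r`,
`dim L_f ≤ r² + (r+1)²/4 + r`, i.e. `4 · dim L_f ≤ 4r² + (r+1)² + 4r`. -/
theorem dim_Lspace_le_of_cubic
    {k : Type*} [Field k] {n : ℕ} (r : ℕ)
    (f : MvPolynomial (Fin n) k) (hf : f.IsHomogeneous 3) (hr : sliceRank f = r) :
    4 * Module.finrank k (Lspace f) ≤ 4 * r ^ 2 + (r + 1) ^ 2 + 4 * r := by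
  rcases (slicePlanes f).eq_empty_or_nonempty with hempty | ⟨P₀, hP₀⟩
  · rw [Lspace, hempty, sSup_empty, finrank_bot]
    omega
  have fP₀ := finiteDimensional_of_le_linearForms hP₀.1
  -- a plane `P₁` as far from `P₀` as possible
  obtain ⟨P₁, hP₁, hmin⟩ := exists_minimalFor_of_wellFoundedLT (· ∈ slicePlanes f)
    (fun P => Module.finrank k (P₀ ⊓ P : Submodule k _)) ⟨P₀, hP₀⟩
  have hmin' : ∀ P ∈ slicePlanes f,
      Module.finrank k (P₀ ⊓ P₁ : Submodule k _) ≤ Module.finrank k (P₀ ⊓ P : Submodule k _) :=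
    fun P hP => (le_total _ _).elim id (hmin hP)
  have fP₁ := finiteDimensional_of_le_linearForms hP₁.1
  obtain ⟨W, hW, hPW, hdep, hdim⟩ := (dependsOnMod_self hP₀.2.2).exists_inf hf hP₀.1 le_rfl
    hP₁.1 hP₁.2.2
  obtain ⟨b, hb⟩ : ∃ b, Module.finrank k (P₀ ⊓ P₁ : Submodule k _) = b := ⟨_, rfl⟩
  have hr₀ : Module.finrank k P₀ = r := hP₀.2.1.trans hr
  have hr₁ : Module.finrank k P₁ = r := hP₁.2.1.trans hr
  have hbr : b ≤ r := by
    rw [← hb, ← hr₀]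
    exact Submodule.finrank_mono inf_le_left
  obtain ⟨s, rfl⟩ := Nat.exists_eq_add_of_le hbr
  obtain ⟨W', fW', hall, hle⟩ := exists_le_of_dependsOnMod hf hP₀ (s := s) (fun P hP => by
    have fP := finiteDimensional_of_le_linearForms hP.1
    have h1 := Submodule.finrank_sup_add_finrank_inf_eq P₀ P
    have h2 := hmin' P hP
    have h3 := hP.2.1
    omega) b W (P₀ ⊓ P₁) hb hW (inf_le_left.trans hPW) hPW hdep
  have hL : Module.finrank k (Lspace f) ≤ Module.finrank k W' :=
    Submodule.finrank_mono (sSup_le hall)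
  have h1 := Submodule.finrank_sup_add_finrank_inf_eq P₀ P₁
  rw [hr₀, hr₁, hb] at h1
  rw [hr₀, hr₁, hb] at hdim
  rw [hr] at hle
  have h2 : Module.finrank k (P₀ ⊔ P₁ : Submodule k _) = b + s + s := by omega
  rw [h2] at hdim
  have h3 : Module.finrank k W ≤ b + s + s + s * (b + s) := by nlinarith
  zify at *
  nlinarith [sq_nonneg ((b : ℤ) + 1 - s)]
end

section
/- Let k be a field, n ≥ 2, and consider the homogeneous cubic f_n = Σ_{1 ≤ i < j ≤ n} x_i x_j y_{ij} in the polynomial ring k[x_i, y_{jk} : 1 ≤ i ≤ n, 1 ≤ j < k ≤ n]. Then dim L_{f_n} = n + n(n−1)/2. -/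
open MvPolynomial

/-- The variables `x_1, …, x_n` together with `y_{ij}` for `1 ≤ i < j ≤ n`. -/
abbrev TestVars (n : ℕ) := Fin n ⊕ {p : Fin n × Fin n // p.1 < p.2}

/-- The cubic `f_n = Σ_{i<j} x_i x_j y_{ij}`. -/
noncomputable def testCubic (k : Type*) [Field k] (n : ℕ) : MvPolynomial (TestVars n) k :=
  ∑ p : {p : Fin n × Fin n // p.1 < p.2},
    X (Sum.inl p.1.1) * X (Sum.inl p.1.2) * X (Sum.inr p)

theorem MvPolynomial.IsHomogeneous.exists_linearMap_eq_eval {R σ : Type*} [CommRing R]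
    {p : MvPolynomial σ R} (hp : p.IsHomogeneous 1) :
    ∃ φ : (σ → R) →ₗ[R] R, ∀ w, φ w = eval w p := by
  rw [← mem_homogeneousSubmodule, homogeneousSubmodule_one_eq_span_X] at hp
  induction hp using Submodule.span_induction with
  | mem x h =>
    obtain ⟨s, rfl⟩ := h
    exact ⟨LinearMap.proj s, fun w => by simp⟩
  | zero => exact ⟨0, fun w => by simp⟩
  | add p q _ _ hp hq =>
    obtain ⟨φ, hφ⟩ := hp
    obtain ⟨ψ, hψ⟩ := hq
    exact ⟨φ + ψ, fun w => by simp [hφ, hψ]⟩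
  | smul a p _ hp =>
    obtain ⟨φ, hφ⟩ := hp
    exact ⟨a • φ, fun w => by simp [hφ, smul_eval]⟩

/-- A polynomial in an ideal generated by `r` linear forms vanishes on a linear subspace of
codimension at most `r`. -/
theorem exists_submodule_eval_eq_zero {k σ : Type*} [Field k] [Fintype σ]
    {f : MvPolynomial σ k} {r : ℕ} (ℓ : Fin r → MvPolynomial σ k)
    (hℓ : ∀ i, (ℓ i).IsHomogeneous 1) (hf : f ∈ Ideal.span (Set.range ℓ)) :
    ∃ W : Submodule k (σ → k), Fintype.card σ ≤ Module.finrank k W + r ∧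
      ∀ w ∈ W, eval w f = 0 := by
  choose φ hφ using fun i => (hℓ i).exists_linearMap_eq_eval
  refine ⟨LinearMap.ker (LinearMap.pi φ), ?_, fun w hw => ?_⟩
  · have h1 := (LinearMap.pi φ).finrank_range_add_finrank_ker
    have h2 := Submodule.finrank_le (LinearMap.range (LinearMap.pi φ))
    simp only [Module.finrank_fintype_fun_eq_card, Fintype.card_fin] at h1 h2
    lia
  · have hle : Ideal.span (Set.range ℓ) ≤ RingHom.ker (eval w) := by
      rw [Ideal.span_le]
      rintro _ ⟨i, rfl⟩
      simpa [← hφ] using congrFun hw i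
    exact hle hf

theorem Submodule.finrank_map_add_finrank_inf_ker {k V V' : Type*} [Field k] [AddCommGroup V]
    [Module k V] [AddCommGroup V'] [Module k V'] [FiniteDimensional k V]
    (W : Submodule k V) (g : V →ₗ[k] V') :
    Module.finrank k (W.map g) + Module.finrank k (W ⊓ LinearMap.ker g : Submodule k V) =
      Module.finrank k W := by
  have h := (g.domRestrict W).finrank_range_add_finrank_ker
  rw [LinearMap.range_domRestrict, LinearMap.ker_domRestrict] at h
  rw [← h, ← Submodule.finrank_map_subtype_eq W, Submodule.map_comap_subtype]

/-- Two orthogonal subspaces for the dot product have complementary dimensions. -/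
theorem Submodule.finrank_add_finrank_le_card_of_dotProduct_eq_zero {k E : Type*} [Field k]
    [Fintype E] (M N : Submodule k (E → k)) (h : ∀ u ∈ M, ∀ v ∈ N, u ⬝ᵥ v = 0) :
    Module.finrank k M + Module.finrank k N ≤ Fintype.card E := by
  classical
  have h1 := Subspace.finrank_add_finrank_dualCoannihilator_eq
    (M.map (dotProductEquiv k E).toLinearMap)
  rw [LinearEquiv.finrank_map_eq, Module.finrank_fintype_fun_eq_card] at h1
  have h2 : N ≤ (M.map (dotProductEquiv k E).toLinearMap).dualCoannihilator := by
    intro v hv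
    rw [Submodule.mem_dualCoannihilator]
    rintro _ ⟨u, hu, rfl⟩
    exact h u hu v hv
  have h3 := Submodule.finrank_mono h2
  lia

/-- The polarization of the quadratic map `x ↦ (x_a x_b)_{a < b}`, with the first argument fixed. -/
def edgePolar {k : Type*} [Field k] {n : ℕ} (u : Fin n → k) :
    (Fin n → k) →ₗ[k] ({p : Fin n × Fin n // p.1 < p.2} → k) where
  toFun v p := u p.1.1 * v p.1.2 + u p.1.2 * v p.1.1
  map_add' v w := by ext p; simp; ring
  map_smul' a v := by ext p; simp; ring

theorem finrank_ker_edgePolar_le {k : Type*} [Field k] {n : ℕ} {u : Fin n → k} (hu : u ≠ 0) :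
    Module.finrank k (LinearMap.ker (edgePolar u)) ≤ 1 := by
  obtain ⟨a, ha⟩ := Function.ne_iff.mp hu
  have key : ∀ v ∈ LinearMap.ker (edgePolar u), v a = 0 → v = 0 := by
    intro v hv hva
    funext b
    rcases lt_trichotomy a b with h | rfl | h
    · have := congrFun hv ⟨(a, b), h⟩
      simpa [edgePolar, hva, show u a ≠ 0 from ha] using this
    · exact hva
    · have := congrFun hv ⟨(b, a), h⟩
      simpa [edgePolar, hva, show u a ≠ 0 from ha] using this
  have hinj : Function.Injective
      ((LinearMap.proj a : (Fin n → k) →ₗ[k] k).domRestrict (LinearMap.ker (edgePolar u))) := by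
    rw [injective_iff_map_eq_zero]
    intro v hv
    exact Subtype.ext (key v v.2 hv)
  simpa using LinearMap.finrank_le_finrank_of_injective hinj

theorem eval_testCubic {k : Type*} [Field k] {n : ℕ} (w : TestVars n → k) :
    eval w (testCubic k n) = ∑ p : {p : Fin n × Fin n // p.1 < p.2},
      w (.inl p.1.1) * w (.inl p.1.2) * w (.inr p) := by
  simp [testCubic]

/-- A linear subspace on which the cubic `f_n` vanishes has codimension at least `n - 1`. -/
theorem finrank_add_le_of_eval_testCubic_eq_zero {k : Type*} [Field k] {n : ℕ}
    (W : Submodule k (TestVars n → k)) (hW : ∀ w ∈ W, eval w (testCubic k n) = 0) :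
    Module.finrank k W + n ≤ Fintype.card (TestVars n) + 1 := by
  set π : (TestVars n → k) →ₗ[k] (Fin n → k) := LinearMap.funLeft k k Sum.inl
  set ρ : (TestVars n → k) →ₗ[k] ({p : Fin n × Fin n // p.1 < p.2} → k) :=
    LinearMap.funLeft k k Sum.inr
  set N := (W ⊓ LinearMap.ker π).map ρ
  have hcard : Fintype.card (TestVars n) =
      n + Fintype.card {p : Fin n × Fin n // p.1 < p.2} := by simp
  have hWdim := W.finrank_map_add_finrank_inf_ker π
  have hN : Module.finrank k N = Module.finrank k (W ⊓ LinearMap.ker π : Submodule k _) := by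
    have hbot : W ⊓ LinearMap.ker π ⊓ LinearMap.ker ρ = ⊥ := by
      rw [eq_bot_iff]
      rintro z ⟨⟨-, hz⟩, hz'⟩
      ext (i | p)
      · exact congrFun hz i
      · exact congrFun hz' p
    have h := (W ⊓ LinearMap.ker π).finrank_map_add_finrank_inf_ker ρ
    rwa [hbot, finrank_bot, add_zero] at h
  have hquad : ∀ x ∈ W.map π, ∀ y ∈ N,
      ∑ p : {p : Fin n × Fin n // p.1 < p.2}, x p.1.1 * x p.1.2 * y p = 0 := by
    rintro _ ⟨w, hw, rfl⟩ _ ⟨z, ⟨hz, hz0⟩, rfl⟩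
    have h1 := hW _ (W.add_mem hw hz)
    have h2 := hW _ hw
    have hz' : ∀ i, z (.inl i) = 0 := congrFun hz0
    rw [eval_testCubic] at h1 h2
    simp only [Pi.add_apply, hz', add_zero, mul_add, Finset.sum_add_distrib, h2, zero_add] at h1
    exact h1
  by_cases hbot : W.map π = ⊥
  · have := N.finrank_le
    rw [hbot, finrank_bot] at hWdim
    rw [Module.finrank_fintype_fun_eq_card] at this
    lia
  · obtain ⟨u, hu, hu0⟩ := Submodule.exists_mem_ne_zero_of_ne_bot hbot
    have hker := finrank_ker_edgePolar_le hu0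
    have hmap := (W.map π).finrank_map_add_finrank_inf_ker (edgePolar u)
    have hinf : Module.finrank k (W.map π ⊓ LinearMap.ker (edgePolar u) : Submodule k _) ≤ _ :=
      Submodule.finrank_mono inf_le_right
    have horth := Submodule.finrank_add_finrank_le_card_of_dotProduct_eq_zero
      ((W.map π).map (edgePolar u)) N (by
        rintro _ ⟨v, hv, rfl⟩ y hy
        have h := hquad _ (add_mem hu hv) y hy
        have h1 := hquad _ hu y hy
        have h2 := hquad _ hv y hy
        rw [← sub_eq_zero_of_eq (sub_eq_zero_of_eq (h.trans h1.symm) |>.trans h2.symm),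
          ← Finset.sum_sub_distrib, ← Finset.sum_sub_distrib]
        refine Finset.sum_congr rfl fun p _ => ?_
        simp only [edgePolar, LinearMap.coe_mk, AddHom.coe_mk, Pi.add_apply]
        ring)
    lia

/-- The cubic `f_n` lies in the ideal of any set of variables meeting each of its monomials. -/
theorem testCubic_mem_span {k : Type*} [Field k] {n : ℕ} {I : Ideal (MvPolynomial (TestVars n) k)}
    (h : ∀ p : {p : Fin n × Fin n // p.1 < p.2},
      X (.inl p.1.1) ∈ I ∨ X (.inl p.1.2) ∈ I ∨ X (.inr p) ∈ I) :
    testCubic k n ∈ I := by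
  refine I.sum_mem fun p _ => ?_
  rcases h p with h | h | h
  · exact I.mul_mem_right _ (I.mul_mem_right _ h)
  · exact I.mul_mem_right _ (I.mul_mem_left _ h)
  · exact I.mul_mem_left _ h

theorem sliceRank_testCubic {k : Type*} [Field k] {n : ℕ} (hn : 1 ≤ n) :
    sliceRank (testCubic k n) = n - 1 := by
  obtain ⟨m, rfl⟩ : ∃ m, n = m + 1 := ⟨n - 1, by lia⟩
  have hmem : m ∈ {r : ℕ | ∃ ℓ : Fin r → MvPolynomial (TestVars (m + 1)) k,
      (∀ i, (ℓ i).IsHomogeneous 1) ∧ testCubic k (m + 1) ∈ Ideal.span (Set.range ℓ)} := by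
    refine ⟨fun i => X (.inl i.succ), fun i => isHomogeneous_X _ _, testCubic_mem_span ?_⟩
    rintro ⟨⟨a, b⟩, hab⟩
    obtain ⟨c, rfl⟩ := Fin.exists_succ_eq.mpr (Fin.ne_zero_of_lt hab)
    exact .inr (.inl (Ideal.subset_span ⟨c, rfl⟩))
  refine le_antisymm (Nat.sInf_le hmem) (le_csInf ⟨m, hmem⟩ ?_)
  rintro r ⟨ℓ, hℓ, hf⟩
  obtain ⟨W, hdim, hW⟩ := exists_submodule_eval_eq_zero ℓ hℓ hf
  have := finrank_add_le_of_eval_testCubic_eq_zero W hW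
  lia

/-- A set of `n - 1` variables meeting every monomial of `f_n` spans a member of `P_{f_n}`. -/
theorem X_mem_Lspace_testCubic {k : Type*} [Field k] {n : ℕ} (hn : 1 ≤ n)
    (S : Finset (TestVars n)) (hS : S.card = n - 1)
    (hcover : ∀ p : {p : Fin n × Fin n // p.1 < p.2},
      .inl p.1.1 ∈ S ∨ .inl p.1.2 ∈ S ∨ .inr p ∈ S) {s : TestVars n} (hs : s ∈ S) :
    X s ∈ Lspace (testCubic k n) := by
  have hX : ∀ t ∈ S, (X t : MvPolynomial (TestVars n) k) ∈ Submodule.span k (X '' S) :=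
    fun t ht => Submodule.subset_span ⟨t, ht, rfl⟩
  suffices hP : Submodule.span k (X '' (S : Set (TestVars n))) ∈ slicePlanes (testCubic k n) from
    le_sSup hP (hX s hs)
  refine ⟨?_, ?_, ?_⟩
  · rw [homogeneousSubmodule_one_eq_span_X]
    exact Submodule.span_mono (Set.image_subset_range _ _)
  · have hli : LinearIndependent k fun s : S => (X s.1 : MvPolynomial (TestVars n) k) :=
      (linearIndependent_X (TestVars n) k).comp _ Subtype.val_injective
    have h := finrank_span_eq_card hli
    rw [Fintype.card_coe, hS] at h
    rw [sliceRank_testCubic hn, ← h, Set.image_eq_range]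
    rfl
  · exact testCubic_mem_span fun p => (hcover p).imp (fun h => Ideal.subset_span (hX _ h))
      (Or.imp (fun h => Ideal.subset_span (hX _ h)) fun h => Ideal.subset_span (hX _ h))

theorem Lspace_testCubic {k : Type*} [Field k] {n : ℕ} (hn : 2 ≤ n) :
    Lspace (testCubic k n) = Submodule.span k (Set.range X) := by
  have hinl (T : Finset (Fin n)) (a : Fin n) :
      (Sum.inl a : TestVars n) ∈ T.map Function.Embedding.inl ↔ a ∈ T := by simp
  refine le_antisymm (sSup_le fun P hP => ?_) (Submodule.span_le.mpr ?_)
  · rw [← homogeneousSubmodule_one_eq_span_X]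
    exact hP.1
  rintro _ ⟨i | q, rfl⟩
  · have : Nontrivial (Fin n) := Fin.nontrivial_iff_two_le.mpr hn
    obtain ⟨j, hj⟩ := exists_ne i
    refine X_mem_Lspace_testCubic (by lia) ((Finset.univ.erase j).map Function.Embedding.inl)
      (by simp) (fun p => ?_) (by simpa using hj.symm)
    simp only [hinl, Finset.mem_erase, Finset.mem_univ, and_true]
    have := p.2.ne
    by_cases h : p.1.1 = j
    · exact .inr (.inl (h ▸ this.symm))
    · exact .inl h
  · refine X_mem_Lspace_testCubic (by lia)
      (Finset.cons (.inr q) (((Finset.univ.erase q.1.1).erase q.1.2).map Function.Embedding.inl)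
        (by simp)) ?_ (fun p => ?_) (by simp)
    · rw [Finset.card_cons, Finset.card_map, Finset.card_erase_of_mem (by simp [q.2.ne']),
        Finset.card_erase_of_mem (by simp), Finset.card_univ, Fintype.card_fin]
      lia
    · obtain ⟨⟨a, b⟩, hab⟩ := p
      obtain ⟨⟨c, d⟩, hcd⟩ := q
      simp only [Finset.mem_cons, hinl, Finset.mem_erase, Finset.mem_univ, and_true]
      simp only [reduceCtorEq, false_or, Sum.inr.injEq, Subtype.mk.injEq, Prod.mk.injEq]
      simp only at hab hcd
      grind

theorem card_fin_prod_lt (n : ℕ) :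
    Fintype.card {p : Fin n × Fin n // p.1 < p.2} = n * (n - 1) / 2 := by
  rw [Fintype.card_subtype, Finset.card_filter, Fintype.sum_prod_type_right]
  simp only [← Finset.card_filter, Finset.filter_gt_eq_Iio, Fin.card_Iio]
  rw [Fin.sum_univ_eq_sum_range (fun i => i), Finset.sum_range_id]

/-- For `n ≥ 2`, the cubic `f_n = Σ_{i<j} x_i x_j y_{ij}` satisfies
`dim L_{f_n} = n + n(n−1)/2`. -/
theorem dim_Lspace_testCubic {k : Type*} [Field k] (n : ℕ) (hn : 2 ≤ n) :
    Module.finrank k (Lspace (testCubic k n)) = n + n * (n - 1) / 2 := by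
  rw [Lspace_testCubic hn, finrank_span_eq_card (linearIndependent_X _ _), Fintype.card_sum,
    Fintype.card_fin, card_fin_prod_lt]
end
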